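/- arXiv:1311.1061 — 6 statements merged into one kernel-verified Lean document; each statement's English description precedes it below -/
import Mathlib

section
/- Let T > 0, let X : [0,T] → ℝ^d be continuous, let h : ℝ^d → ℝ^d be continuous, and let C : ℝ^d → Sym_d(ℝ) be continuous with C(x) positive definite for every x. Then the symmetric bilinear form B_X on d×d real matrices defined by B_X(M,N) := ∫₀^T ⟨M h(X_s), C(X_s)^{-1} N h(X_s)⟩ ds is positive definite (equivalently, the associated linear map on d×d matrices is invertible) if and only if span{ h(X_t) : t ∈ [0,T] } = ℝ^d. -/
open MeasureTheory Matrix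

theorem Matrix.continuous_inv_of_forall_posDef {α n : Type*} [TopologicalSpace α] [Fintype n]
    [DecidableEq n] {C : α → Matrix n n ℝ} (hC : Continuous C) (hpd : ∀ x, (C x).PosDef) :
    Continuous fun x => (C x)⁻¹ := by
  simp only [Matrix.inv_def, Ring.inverse_eq_inv']
  exact (hC.matrix_det.inv₀ fun x => (hpd x).det_pos.ne').smul hC.matrix_adjugate

/-- A proper subspace of `ℝⁿ` is annihilated by some nonzero square matrix. -/
theorem Matrix.exists_ne_zero_mulVec_eq_zero_of_lt_top {n : Type*} [Fintype n]
    {S : Submodule ℝ (n → ℝ)} (hS : S < ⊤) :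
    ∃ M : Matrix n n ℝ, M ≠ 0 ∧ ∀ v ∈ S, M.mulVec v = 0 := by
  classical
  obtain ⟨f, hf, hle⟩ := S.exists_le_ker_of_lt_top hS
  obtain ⟨x, hx⟩ := DFunLike.exists_ne hf
  have hx0 : x ≠ 0 := by
    rintro rfl
    simp at hx
  refine ⟨LinearMap.toMatrix' (f.smulRight x), fun hM => ?_, fun v hv => ?_⟩
  · have hMx : f x • x = 0 := by
      simpa [LinearMap.toMatrix'_mulVec] using congrArg (fun A => Matrix.mulVec A x) hM
    exact (smul_ne_zero hx hx0) hMx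
  · have hv0 : f v = 0 := hle hv
    simp [LinearMap.toMatrix'_mulVec, hv0]

/-- A nonzero matrix does not annihilate any spanning set. -/
theorem Matrix.exists_mem_mulVec_ne_zero_of_span_eq_top {n : Type*} [Fintype n]
    {s : Set (n → ℝ)} (hs : Submodule.span ℝ s = ⊤) {M : Matrix n n ℝ} (hM : M ≠ 0) :
    ∃ v ∈ s, M.mulVec v ≠ 0 := by
  classical
  by_contra! hcon
  refine hM (Matrix.toLin'.injective (LinearMap.ext_on hs fun v hv => ?_))
  simpa using hcon v hv

/-- For a continuous observation path `X : [0,T] → ℝ^d`, continuous `h` and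
continuous, pointwise positive definite (symmetric) `C`, the observed Fisher information
bilinear form `B_X(M,N) = ∫₀^T ⟨M h(X_s), C(X_s)⁻¹ N h(X_s)⟩ ds` on `d×d` matrices is
positive definite if and only if `span{h(X_t) : t ∈ [0,T]} = ℝ^d`. -/
theorem fisher_information_posDef_iff_span {d : ℕ} (T : ℝ) (hT : 0 < T)
    (X : ℝ → Fin d → ℝ) (hX : ContinuousOn X (Set.Icc 0 T))
    (h : (Fin d → ℝ) → Fin d → ℝ) (hh : Continuous h)
    (C : (Fin d → ℝ) → Matrix (Fin d) (Fin d) ℝ) (hC : Continuous C)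
    (hCpd : ∀ x, (C x).PosDef) :
    (∀ M : Matrix (Fin d) (Fin d) ℝ, M ≠ 0 →
        0 < ∫ s in (0:ℝ)..T,
          (M.mulVec (h (X s))) ⬝ᵥ ((C (X s))⁻¹.mulVec (M.mulVec (h (X s))))) ↔
      Submodule.span ℝ ((fun t => h (X t)) '' Set.Icc 0 T) = ⊤ := by
  constructor
  · intro hpos
    by_contra hne
    obtain ⟨M, hM, hzero⟩ :=
      Matrix.exists_ne_zero_mulVec_eq_zero_of_lt_top (lt_top_iff_ne_top.2 hne)
    refine (hpos M hM).ne' ?_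
    refine intervalIntegral.integral_zero_ae (Filter.Eventually.of_forall fun s hs => ?_)
    rw [Set.uIoc_of_le hT.le] at hs
    rw [hzero _ (Submodule.subset_span ⟨s, Set.Ioc_subset_Icc_self hs, rfl⟩), zero_dotProduct]
  · intro hspan M hM
    obtain ⟨_, ⟨t, ht, rfl⟩, hne⟩ := Matrix.exists_mem_mulVec_ne_zero_of_span_eq_top hspan hM
    have hcont : Continuous fun x => M.mulVec (h x) ⬝ᵥ (C x)⁻¹.mulVec (M.mulVec (h x)) := by
      have hMh : Continuous fun x => M.mulVec (h x) := continuous_const.matrix_mulVec hh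
      exact hMh.dotProduct ((Matrix.continuous_inv_of_forall_posDef hC hCpd).matrix_mulVec hMh)
    refine intervalIntegral.integral_pos hT (hcont.comp_continuousOn hX) (fun s _ => ?_)
      ⟨t, ht, ?_⟩
    · simpa using (hCpd (X s)).inv.posSemidef.dotProduct_mulVec_nonneg (M.mulVec (h (X s)))
    · simpa using (hCpd (X t)).inv.dotProduct_mulVec_pos hne
end

section
/- Let α ∈ (1/3, 1/2], K > 0, and let 𝐗 = (X, 𝕏) and 𝐗ₙ = (Xₙ, 𝕏ₙ), n ∈ ℕ, all satisfy the bounds ‖X_{s,t}‖ ≤ K|t−s|^α, ‖𝕏_{s,t}‖ ≤ K|t−s|^{2α} and Chen's relation 𝕏_{s,u} = 𝕏_{s,t} + X_{s,t} ⊗ X_{t,u} + 𝕏_{t,u} on [0,T]. Assume ρ_α(𝐗ₙ, 𝐗) → 0, where ρ_α(𝐗,𝐘) := sup_{s≠t} ‖X_{s,t} − Y_{s,t}‖/|t−s|^α + sup_{s≠t} ‖𝕏_{s,t} − 𝕐_{s,t}‖/|t−s|^{2α}, and that Xₙ(0) → X(0). Let F : ℝ^d → L(ℝ^d, ℝ^m)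 be three times continuously differentiable with F and all derivatives bounded. Then the rough integrals converge: ∫₀^T F(Xₙ,s) d𝐗ₙ,s → ∫₀^T F(X_s) d𝐗_s, where each rough integral is defined as the limit of the compensated Riemann sums Σ_i [F(X_{t_i}) X_{t_i,t_{i+1}} + DF(X_{t_i}) 𝕏_{t_i,t_{i+1}}] over partitions of vanishing mesh. -/
open MeasureTheory

/-- The compensated Riemann sum `Σᵢ [F(X_{tᵢ}) X_{tᵢ,tᵢ₊₁} + DF(X_{tᵢ}) 𝕏_{tᵢ,tᵢ₊₁}]`
associated to a partition `t : Fin (N+1) → ℝ`; `DF(X_{tᵢ}) 𝕏_{tᵢ,tᵢ₊₁}` is the canonical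
contraction of the derivative of `F` against the second-order tensor `𝕏`. -/
noncomputable def compensatedRiemannSum {d m : ℕ}
    (F : EuclideanSpace ℝ (Fin d) → EuclideanSpace ℝ (Fin d) →L[ℝ] EuclideanSpace ℝ (Fin m))
    (X : ℝ → EuclideanSpace ℝ (Fin d)) (𝕏 : ℝ → ℝ → EuclideanSpace ℝ (Fin d × Fin d))
    (N : ℕ) (t : Fin (N + 1) → ℝ) : EuclideanSpace ℝ (Fin m) :=
  ∑ i : Fin N,
    (F (X (t i.castSucc)) (X (t i.succ) - X (t i.castSucc)) +
      ∑ p : Fin d × Fin d,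
        𝕏 (t i.castSucc) (t i.succ) p •
          fderiv ℝ F (X (t i.castSucc)) (EuclideanSpace.single p.1 1)
            (EuclideanSpace.single p.2 1))

/-- `I` is the rough integral `∫₀^T F(X) d𝐗`: the limit of the compensated Riemann sums
over partitions of `[0,T]` of vanishing mesh. -/
def IsRoughIntegral {d m : ℕ} (T : ℝ)
    (F : EuclideanSpace ℝ (Fin d) → EuclideanSpace ℝ (Fin d) →L[ℝ] EuclideanSpace ℝ (Fin m))
    (X : ℝ → EuclideanSpace ℝ (Fin d)) (𝕏 : ℝ → ℝ → EuclideanSpace ℝ (Fin d × Fin d))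
    (I : EuclideanSpace ℝ (Fin m)) : Prop :=
  ∀ ε > 0, ∃ δ > 0,
    ∀ (N : ℕ) (t : Fin (N + 1) → ℝ), StrictMono t → t 0 = 0 → t (Fin.last N) = T →
      (∀ i : Fin N, t i.succ - t i.castSucc < δ) →
      ‖compensatedRiemannSum F X 𝕏 N t - I‖ < ε

open Filter Topology Set

section Taylor

variable {E G : Type*} [NormedAddCommGroup E] [NormedSpace ℝ E]
  [NormedAddCommGroup G] [NormedSpace ℝ G] {F : E → G} {B : ℝ}

lemma norm_fderiv_sub_fderiv_le_of_iteratedFDeriv_two_le (hF : ContDiff ℝ 2 F)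
    (hB : ∀ x, ‖iteratedFDeriv ℝ 2 F x‖ ≤ B) (x y : E) :
    ‖fderiv ℝ F y - fderiv ℝ F x‖ ≤ B * ‖y - x‖ := by
  have hd : Differentiable ℝ (fderiv ℝ F) :=
    (hF.fderiv_right (m := 1) (by norm_num)).differentiable (by norm_num)
  refine convex_univ.norm_image_sub_le_of_norm_fderiv_le (fun z _ => hd z) (fun z _ => ?_)
    (mem_univ x) (mem_univ y)
  rw [← norm_iteratedFDeriv_one, norm_iteratedFDeriv_fderiv]
  exact hB z

lemma norm_sub_sub_fderiv_le_of_iteratedFDeriv_two_le (hF : ContDiff ℝ 2 F)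
    (hB : ∀ x, ‖iteratedFDeriv ℝ 2 F x‖ ≤ B) (x y : E) :
    ‖F y - F x - fderiv ℝ F x (y - x)‖ ≤ B * ‖y - x‖ ^ 2 := by
  have hB0 : 0 ≤ B := (norm_nonneg _).trans (hB x)
  have hd : Differentiable ℝ F := hF.differentiable (by norm_num)
  have h := (convex_segment x y).norm_image_sub_le_of_norm_fderiv_le' (𝕜 := ℝ) (f := F)
    (φ := fderiv ℝ F x) (C := B * ‖y - x‖) (fun z _ => hd z) (fun z hz => ?_)
    (left_mem_segment ℝ x y) (right_mem_segment ℝ x y)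
  · rwa [mul_assoc, ← sq] at h
  · refine (norm_fderiv_sub_fderiv_le_of_iteratedFDeriv_two_le hF hB x z).trans ?_
    gcongr
    exact norm_sub_le_of_mem_segment hz

end Taylor

section Contraction

variable {ι H : Type*} [Fintype ι] [DecidableEq ι] [NormedAddCommGroup H] [NormedSpace ℝ H]

/-- The contraction of a bilinear map against a second-order tensor. -/
noncomputable def tensorContraction
    (A : EuclideanSpace ℝ ι →L[ℝ] EuclideanSpace ℝ ι →L[ℝ] H)
    (Z : EuclideanSpace ℝ (ι × ι)) : H :=
  ∑ p : ι × ι, Z p • A (EuclideanSpace.single p.1 1) (EuclideanSpace.single p.2 1)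

lemma norm_tensorContraction_le (A : EuclideanSpace ℝ ι →L[ℝ] EuclideanSpace ℝ ι →L[ℝ] H)
    (Z : EuclideanSpace ℝ (ι × ι)) :
    ‖tensorContraction A Z‖ ≤ Fintype.card (ι × ι) * (‖A‖ * ‖Z‖) := by
  have hp : ∀ p ∈ (Finset.univ : Finset (ι × ι)),
      ‖Z p • A (EuclideanSpace.single p.1 1) (EuclideanSpace.single p.2 1)‖ ≤ ‖A‖ * ‖Z‖ := by
    intro p _
    rw [norm_smul, mul_comm]
    gcongr
    · refine (A.le_opNorm₂ _ _).trans ?_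
      simp
    · exact PiLp.norm_apply_le Z p
  simpa [tensorContraction, nsmul_eq_mul] using norm_sum_le_of_le _ hp

lemma tensorContraction_sub_left (A A' : EuclideanSpace ℝ ι →L[ℝ] EuclideanSpace ℝ ι →L[ℝ] H)
    (Z : EuclideanSpace ℝ (ι × ι)) :
    tensorContraction (A - A') Z = tensorContraction A Z - tensorContraction A' Z := by
  simp [tensorContraction, smul_sub]

lemma tensorContraction_eq_of_eq_add_mul_add
    (A : EuclideanSpace ℝ ι →L[ℝ] EuclideanSpace ℝ ι →L[ℝ] H)
    {Z Z₁ Z₂ : EuclideanSpace ℝ (ι × ι)} {v w : EuclideanSpace ℝ ι}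
    (h : ∀ p, Z p = Z₁ p + v p.1 * w p.2 + Z₂ p) :
    tensorContraction A Z = tensorContraction A Z₁ + A v w + tensorContraction A Z₂ := by
  have hbasis (x : EuclideanSpace ℝ ι) : x = ∑ i, x i • EuclideanSpace.single i (1 : ℝ) := by
    simpa using ((EuclideanSpace.basisFun ι ℝ).sum_repr x).symm
  have hvw : A v w = ∑ p : ι × ι,
      (v p.1 * w p.2) • A (EuclideanSpace.single p.1 1) (EuclideanSpace.single p.2 1) := by
    conv_lhs => rw [hbasis v, hbasis w]
    simp only [map_sum, map_smul, _root_.sum_apply, _root_.smul_apply,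
      Fintype.sum_prod_type, Finset.smul_sum, smul_smul]
    rw [Finset.sum_comm]
    simp only [mul_comm]
  simp only [tensorContraction, h, add_smul, Finset.sum_add_distrib, hvw]

end Contraction

section Germ

variable {d m : ℕ}

/-- The compensated germ `F(X_s) X_{s,t} + DF(X_s) 𝕏_{s,t}` of the rough integral. -/
noncomputable def roughGerm
    (F : EuclideanSpace ℝ (Fin d) → EuclideanSpace ℝ (Fin d) →L[ℝ] EuclideanSpace ℝ (Fin m))
    (X : ℝ → EuclideanSpace ℝ (Fin d)) (𝕏 : ℝ → ℝ → EuclideanSpace ℝ (Fin d × Fin d))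
    (s t : ℝ) : EuclideanSpace ℝ (Fin m) :=
  F (X s) (X t - X s) + tensorContraction (fderiv ℝ F (X s)) (𝕏 s t)

lemma compensatedRiemannSum_eq_sum_range_roughGerm
    (F : EuclideanSpace ℝ (Fin d) → EuclideanSpace ℝ (Fin d) →L[ℝ] EuclideanSpace ℝ (Fin m))
    (X : ℝ → EuclideanSpace ℝ (Fin d)) (𝕏 : ℝ → ℝ → EuclideanSpace ℝ (Fin d × Fin d))
    (N : ℕ) (τ : ℕ → ℝ) :
    compensatedRiemannSum F X 𝕏 N (fun i => τ i) =
      ∑ i ∈ Finset.range N, roughGerm F X 𝕏 (τ i) (τ (i + 1)) := by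
  rw [← Fin.sum_univ_eq_sum_range (fun i => roughGerm F X 𝕏 (τ i) (τ (i + 1)))]
  simp [compensatedRiemannSum, roughGerm, tensorContraction]

lemma norm_roughGerm_sub_add_le {T K α B : ℝ} (hK : 0 ≤ K) (hα : 0 ≤ α)
    {F : EuclideanSpace ℝ (Fin d) → EuclideanSpace ℝ (Fin d) →L[ℝ] EuclideanSpace ℝ (Fin m)}
    (hF : ContDiff ℝ 2 F) (hB : ∀ x, ‖iteratedFDeriv ℝ 2 F x‖ ≤ B)
    {X : ℝ → EuclideanSpace ℝ (Fin d)} {𝕏 : ℝ → ℝ → EuclideanSpace ℝ (Fin d × Fin d)}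
    (hX : ∀ s ∈ Icc (0 : ℝ) T, ∀ t ∈ Icc (0 : ℝ) T, ‖X t - X s‖ ≤ K * |t - s| ^ α)
    (h𝕏 : ∀ s ∈ Icc (0 : ℝ) T, ∀ t ∈ Icc (0 : ℝ) T, ‖𝕏 s t‖ ≤ K * |t - s| ^ (2 * α))
    (hchen : ∀ s ∈ Icc (0 : ℝ) T, ∀ t ∈ Icc (0 : ℝ) T, ∀ u ∈ Icc (0 : ℝ) T,
      ∀ p : Fin d × Fin d,
        𝕏 s u p = 𝕏 s t p + (X t p.1 - X s p.1) * (X u p.2 - X t p.2) + 𝕏 t u p)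
    {s t u : ℝ} (hs : 0 ≤ s) (hst : s ≤ t) (htu : t ≤ u) (hu : u ≤ T) :
    ‖roughGerm F X 𝕏 s u - (roughGerm F X 𝕏 s t + roughGerm F X 𝕏 t u)‖ ≤
      (B * K ^ 3 + Fintype.card (Fin d × Fin d) * (B * K ^ 2)) * (u - s) ^ (3 * α) := by
  have hB0 : 0 ≤ B := (norm_nonneg _).trans (hB 0)
  have hs' : s ∈ Icc 0 T := ⟨hs, by linarith⟩
  have ht' : t ∈ Icc 0 T := ⟨by linarith, by linarith⟩
  have hu' : u ∈ Icc 0 T := ⟨by linarith, hu⟩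
  have hus : 0 ≤ u - s := by linarith
  have habs₁ : |t - s| ≤ u - s := by rw [abs_of_nonneg] <;> linarith
  have habs₂ : |u - t| ≤ u - s := by rw [abs_of_nonneg] <;> linarith
  set h := (u - s) ^ α with hh
  have hh0 : 0 ≤ h := Real.rpow_nonneg hus _
  have hh2 : (u - s) ^ (2 * α) = h ^ 2 := by
    rw [hh, ← Real.rpow_mul_natCast hus]; congr 1; push_cast; ring
  have hh3 : (u - s) ^ (3 * α) = h ^ 3 := by
    rw [hh, ← Real.rpow_mul_natCast hus]; congr 1; push_cast; ring
  have hXst : ‖X t - X s‖ ≤ K * h := (hX s hs' t ht').trans (by rw [hh]; gcongr)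
  have hXtu : ‖X u - X t‖ ≤ K * h := (hX t ht' u hu').trans (by rw [hh]; gcongr)
  have h𝕏tu : ‖𝕏 t u‖ ≤ K * h ^ 2 := (h𝕏 t ht' u hu').trans (by rw [← hh2]; gcongr)
  have hchen' := tensorContraction_eq_of_eq_add_mul_add (fderiv ℝ F (X s)) (v := X t - X s)
    (w := X u - X t) (hchen s hs' t ht' u hu')
  have hkey : roughGerm F X 𝕏 s u - (roughGerm F X 𝕏 s t + roughGerm F X 𝕏 t u) =
      -((F (X t) - F (X s) - fderiv ℝ F (X s) (X t - X s)) (X u - X t) +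
        tensorContraction (fderiv ℝ F (X t) - fderiv ℝ F (X s)) (𝕏 t u)) := by
    rw [tensorContraction_sub_left]
    simp only [roughGerm, hchen', _root_.sub_apply, map_sub]
    abel
  rw [hkey, norm_neg, hh3]
  calc _ ≤ B * (K * h) ^ 2 * (K * h) +
        Fintype.card (Fin d × Fin d) * (B * (K * h) * (K * h ^ 2)) := by
        refine (norm_add_le _ _).trans (add_le_add ?_ ?_)
        · refine (ContinuousLinearMap.le_opNorm _ _).trans ?_
          gcongr
          refine (norm_sub_sub_fderiv_le_of_iteratedFDeriv_two_le hF hB _ _).trans ?_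
          gcongr
        · refine (norm_tensorContraction_le _ _).trans ?_
          gcongr
          refine (norm_fderiv_sub_fderiv_le_of_iteratedFDeriv_two_le hF hB _ _).trans ?_
          gcongr
    _ = _ := by ring

lemma tendsto_roughGerm {β : Type*} {l : Filter β}
    {F : EuclideanSpace ℝ (Fin d) → EuclideanSpace ℝ (Fin d) →L[ℝ] EuclideanSpace ℝ (Fin m)}
    (hF : ContDiff ℝ 1 F)
    {X : ℝ → EuclideanSpace ℝ (Fin d)} {𝕏 : ℝ → ℝ → EuclideanSpace ℝ (Fin d × Fin d)}
    {Y : β → ℝ → EuclideanSpace ℝ (Fin d)} {𝕐 : β → ℝ → ℝ → EuclideanSpace ℝ (Fin d × Fin d)}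
    {s t : ℝ} (hs : Tendsto (fun n => Y n s) l (𝓝 (X s)))
    (ht : Tendsto (fun n => Y n t) l (𝓝 (X t)))
    (hst : Tendsto (fun n => 𝕐 n s t) l (𝓝 (𝕏 s t))) :
    Tendsto (fun n => roughGerm F (Y n) (𝕐 n) s t) l (𝓝 (roughGerm F X 𝕏 s t)) := by
  have hDF : Continuous (fderiv ℝ F) := hF.continuous_fderiv (by norm_num)
  have hcont : Continuous fun q : EuclideanSpace ℝ (Fin d) × EuclideanSpace ℝ (Fin d) ×
      EuclideanSpace ℝ (Fin d × Fin d) =>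
        F q.1 (q.2.1 - q.1) + tensorContraction (fderiv ℝ F q.1) q.2.2 := by
    have := hF.continuous
    unfold tensorContraction
    fun_prop
  have hlim := (hcont.tendsto (X s, X t, 𝕏 s t)).comp (hs.prodMk_nhds (ht.prodMk_nhds hst))
  exact hlim

end Germ

section Dyadic

lemma sum_range_two_mul {M : Type*} [AddCommMonoid M] (f : ℕ → M) (n : ℕ) :
    ∑ i ∈ Finset.range (2 * n), f i = ∑ i ∈ Finset.range n, (f (2 * i) + f (2 * i + 1)) := by
  induction n with
  | zero => simp
  | succ n ih => rw [mul_add, mul_one, Finset.sum_range_succ, Finset.sum_range_succ, ih,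
      Finset.sum_range_succ, add_assoc]

/-- The sum of a two-parameter germ over the dyadic partition of `[0,T]` with `2 ^ k` intervals. -/
noncomputable def dyadicSum {H : Type*} [AddCommMonoid H] (T : ℝ) (Ξ : ℝ → ℝ → H) (k : ℕ) : H :=
  ∑ i ∈ Finset.range (2 ^ k), Ξ (T * i / 2 ^ k) (T * (i + 1 : ℕ) / 2 ^ k)

lemma dyadic_mem_Icc {T : ℝ} (hT : 0 ≤ T) {i k : ℕ} (hi : i ≤ 2 ^ k) :
    T * i / 2 ^ k ∈ Icc 0 T := by
  have hi' : (i : ℝ) ≤ 2 ^ k := by exact_mod_cast hi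
  refine ⟨by positivity, ?_⟩
  rw [div_le_iff₀ (by positivity)]
  gcongr

lemma dist_dyadicSum_le {H : Type*} [NormedAddCommGroup H] {T C θ : ℝ} (hT : 0 ≤ T)
    {Ξ : ℝ → ℝ → H}
    (hΞ : ∀ s t u : ℝ, 0 ≤ s → s ≤ t → t ≤ u → u ≤ T →
      ‖Ξ s u - (Ξ s t + Ξ t u)‖ ≤ C * (u - s) ^ θ) (k : ℕ) :
    dist (dyadicSum T Ξ k) (dyadicSum T Ξ (k + 1)) ≤
      C * T ^ θ * (2 * (1 / 2 : ℝ) ^ θ) ^ k := by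
  rw [dist_eq_norm, dyadicSum, dyadicSum, pow_succ', sum_range_two_mul, ← Finset.sum_sub_distrib]
  have hterm : ∀ i ∈ Finset.range (2 ^ k),
      ‖Ξ (T * i / 2 ^ k) (T * (i + 1 : ℕ) / 2 ^ k) -
        (Ξ (T * (2 * i : ℕ) / 2 ^ (k + 1)) (T * (2 * i + 1 : ℕ) / 2 ^ (k + 1)) +
          Ξ (T * (2 * i + 1 : ℕ) / 2 ^ (k + 1)) (T * (2 * i + 1 + 1 : ℕ) / 2 ^ (k + 1)))‖ ≤
      C * (T * (1 / 2) ^ k) ^ θ := by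
    intro i hi
    have hleft : T * (2 * i : ℕ) / 2 ^ (k + 1) = T * i / 2 ^ k := by
      push_cast; field_simp; ring
    have hright : T * (2 * i + 1 + 1 : ℕ) / 2 ^ (k + 1) = T * (i + 1 : ℕ) / 2 ^ k := by
      push_cast; field_simp; ring
    have hlen : T * (1 / 2) ^ k = T * (i + 1 : ℕ) / 2 ^ k - T * i / 2 ^ k := by
      rw [one_div_pow]; push_cast; field_simp; ring
    rw [hlen, hleft, hright]
    refine hΞ _ _ _ (by positivity) ?_ ?_ (dyadic_mem_Icc hT (Finset.mem_range.mp hi)).2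
    · rw [← hleft]; gcongr; omega
    · rw [← hright]; gcongr; omega
  refine (norm_sum_le_of_le _ hterm).trans (le_of_eq ?_)
  rw [Finset.sum_const, Finset.card_range, nsmul_eq_mul, Real.mul_rpow hT (by positivity),
    ← Real.rpow_pow_comm (by norm_num), mul_pow]
  push_cast
  ring

lemma IsRoughIntegral.tendsto_dyadicSum {d m : ℕ} {T : ℝ} (hT : 0 < T)
    {F : EuclideanSpace ℝ (Fin d) → EuclideanSpace ℝ (Fin d) →L[ℝ] EuclideanSpace ℝ (Fin m)}
    {X : ℝ → EuclideanSpace ℝ (Fin d)} {𝕏 : ℝ → ℝ → EuclideanSpace ℝ (Fin d × Fin d)}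
    {I : EuclideanSpace ℝ (Fin m)} (hI : IsRoughIntegral T F X 𝕏 I) :
    Tendsto (dyadicSum T (roughGerm F X 𝕏)) atTop (𝓝 I) := by
  rw [Metric.tendsto_nhds]
  intro ε hε
  obtain ⟨δ, hδ, h⟩ := hI ε hε
  have hmesh : Tendsto (fun k : ℕ => T * (1 / 2 : ℝ) ^ k) atTop (𝓝 0) := by
    simpa using (tendsto_pow_atTop_nhds_zero_of_lt_one (by norm_num : (0 : ℝ) ≤ 1 / 2)
      (by norm_num)).const_mul T
  filter_upwards [hmesh.eventually (gt_mem_nhds hδ)] with k hk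
  rw [dist_eq_norm, dyadicSum,
    ← compensatedRiemannSum_eq_sum_range_roughGerm F X 𝕏 (2 ^ k) (fun i => T * i / 2 ^ k)]
  refine h _ _ (fun i j hij => ?_) (by simp) (by simp) (fun i => ?_)
  · have hij' : ((i : ℕ) : ℝ) < (j : ℕ) := by exact_mod_cast hij
    gcongr
  · refine lt_of_eq_of_lt ?_ hk
    simp only [Fin.val_succ, Fin.val_castSucc, one_div_pow]
    push_cast
    field_simp
    ring

end Dyadic

lemma tendsto_of_norm_sub_div_lt {H : Type*} [NormedAddCommGroup H] {f : ℕ → H} {a : H} {c : ℝ}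
    (hc : 0 < c) (h : ∀ ε > 0, ∃ N, ∀ n ≥ N, ‖f n - a‖ / c < ε) :
    Tendsto f atTop (𝓝 a) := by
  rw [Metric.tendsto_atTop]
  intro ε hε
  obtain ⟨N, hN⟩ := h (ε / c) (by positivity)
  refine ⟨N, fun n hn => ?_⟩
  rw [dist_eq_norm]
  exact (div_lt_div_iff_of_pos_right hc).1 (hN n hn)

/-- Continuity of rough integration: if α-Hölder rough paths `𝐗ₙ = (Xₙ, 𝕏ₙ)`
(all satisfying the analytic bounds with a common constant `K` and Chen's relation on `[0,T]`)
converge to `𝐗 = (X, 𝕏)` in the α-Hölder rough path metric `ρ_α` and `Xₙ(0) → X(0)`, and if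
`F ∈ C³` with `F` and all derivatives bounded, then the rough integrals converge:
`∫₀^T F(Xₙ) d𝐗ₙ → ∫₀^T F(X) d𝐗`. -/
theorem rough_integral_continuous {d m : ℕ} (T K α B : ℝ) (hT : 0 < T) (hK : 0 < K)
    (hα : 1 / 3 < α) (hα' : α ≤ 1 / 2)
    (X : ℝ → EuclideanSpace ℝ (Fin d))
    (𝕏 : ℝ → ℝ → EuclideanSpace ℝ (Fin d × Fin d))
    (Xn : ℕ → ℝ → EuclideanSpace ℝ (Fin d))
    (𝕏n : ℕ → ℝ → ℝ → EuclideanSpace ℝ (Fin d × Fin d))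
    (hana₁ : ∀ s ∈ Set.Icc (0:ℝ) T, ∀ t ∈ Set.Icc (0:ℝ) T, ‖X t - X s‖ ≤ K * |t - s| ^ α)
    (hana₂ : ∀ s ∈ Set.Icc (0:ℝ) T, ∀ t ∈ Set.Icc (0:ℝ) T, ‖𝕏 s t‖ ≤ K * |t - s| ^ (2 * α))
    (halg : ∀ s ∈ Set.Icc (0:ℝ) T, ∀ t ∈ Set.Icc (0:ℝ) T, ∀ u ∈ Set.Icc (0:ℝ) T,
      ∀ p : Fin d × Fin d,
        𝕏 s u p = 𝕏 s t p + (X t p.1 - X s p.1) * (X u p.2 - X t p.2) + 𝕏 t u p)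
    (hana₁n : ∀ n, ∀ s ∈ Set.Icc (0:ℝ) T, ∀ t ∈ Set.Icc (0:ℝ) T,
      ‖Xn n t - Xn n s‖ ≤ K * |t - s| ^ α)
    (hana₂n : ∀ n, ∀ s ∈ Set.Icc (0:ℝ) T, ∀ t ∈ Set.Icc (0:ℝ) T,
      ‖𝕏n n s t‖ ≤ K * |t - s| ^ (2 * α))
    (halgn : ∀ n, ∀ s ∈ Set.Icc (0:ℝ) T, ∀ t ∈ Set.Icc (0:ℝ) T, ∀ u ∈ Set.Icc (0:ℝ) T,
      ∀ p : Fin d × Fin d,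
        𝕏n n s u p =
          𝕏n n s t p + (Xn n t p.1 - Xn n s p.1) * (Xn n u p.2 - Xn n t p.2) + 𝕏n n t u p)
    (hρ : ∀ ε > 0, ∃ N₀ : ℕ, ∀ n ≥ N₀, ∀ s ∈ Set.Icc (0:ℝ) T, ∀ t ∈ Set.Icc (0:ℝ) T, s ≠ t →
      ‖(Xn n t - Xn n s) - (X t - X s)‖ / |t - s| ^ α +
        ‖𝕏n n s t - 𝕏 s t‖ / |t - s| ^ (2 * α) < ε)
    (hX0 : Filter.Tendsto (fun n => Xn n 0) Filter.atTop (nhds (X 0)))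
    (F : EuclideanSpace ℝ (Fin d) → EuclideanSpace ℝ (Fin d) →L[ℝ] EuclideanSpace ℝ (Fin m))
    (hF : ContDiff ℝ 3 F)
    (hFb : ∀ i : ℕ, i ≤ 3 → ∀ x, ‖iteratedFDeriv ℝ i F x‖ ≤ B)
    (I : EuclideanSpace ℝ (Fin m)) (In : ℕ → EuclideanSpace ℝ (Fin m))
    (hI : IsRoughIntegral T F X 𝕏 I)
    (hIn : ∀ n, IsRoughIntegral T F (Xn n) (𝕏n n) (In n)) :
    Filter.Tendsto In Filter.atTop (nhds I) := by
  have hα0 : 0 < α := by linarith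
  have hpos {s t : ℝ} (hst : s ≠ t) (θ : ℝ) : 0 < |t - s| ^ θ :=
    Real.rpow_pos_of_pos (abs_pos.2 (sub_ne_zero.2 hst.symm)) θ
  have hXlim : ∀ t ∈ Icc 0 T, Tendsto (fun n => Xn n t) atTop (𝓝 (X t)) := by
    intro t ht
    rcases eq_or_ne 0 t with rfl | h0t
    · exact hX0
    have hincr : Tendsto (fun n => Xn n t - Xn n 0) atTop (𝓝 (X t - X 0)) := by
      refine tendsto_of_norm_sub_div_lt (hpos h0t α) fun ε hε => ?_
      obtain ⟨N, hN⟩ := hρ ε hε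
      refine ⟨N, fun n hn => lt_of_le_of_lt ?_ (hN n hn 0 (left_mem_Icc.2 hT.le) t ht h0t)⟩
      exact le_add_of_nonneg_right (by positivity)
    simpa using hincr.add hX0
  have h𝕏lim : ∀ s ∈ Icc 0 T, ∀ t ∈ Icc 0 T, s ≠ t →
      Tendsto (fun n => 𝕏n n s t) atTop (𝓝 (𝕏 s t)) := by
    intro s hs t ht hst
    refine tendsto_of_norm_sub_div_lt (hpos hst (2 * α)) fun ε hε => ?_
    obtain ⟨N, hN⟩ := hρ ε hε
    refine ⟨N, fun n hn => lt_of_le_of_lt ?_ (hN n hn s hs t ht hst)⟩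
    exact le_add_of_nonneg_left (by positivity)
  have hSlim (k : ℕ) : Tendsto (fun n => dyadicSum T (roughGerm F (Xn n) (𝕏n n)) k) atTop
      (𝓝 (dyadicSum T (roughGerm F X 𝕏) k)) := by
    refine tendsto_finsetSum _ fun i hi => ?_
    have hs := dyadic_mem_Icc hT.le (Finset.mem_range.1 hi).le
    have ht := dyadic_mem_Icc hT.le (Finset.mem_range.1 hi)
    refine tendsto_roughGerm (hF.of_le (by norm_num)) (hXlim _ hs) (hXlim _ ht)
      (h𝕏lim _ hs _ ht (ne_of_lt ?_))
    gcongr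
    exact i.lt_succ_self
  have hF2 : ContDiff ℝ 2 F := hF.of_le (by norm_num)
  set r : ℝ := 2 * (1 / 2 : ℝ) ^ (3 * α) with hr
  set C : ℝ := (B * K ^ 3 + Fintype.card (Fin d × Fin d) * (B * K ^ 2)) * T ^ (3 * α)
  have hr0 : 0 ≤ r := by positivity
  have hr1 : r < 1 := by
    have := Real.rpow_lt_rpow_of_exponent_gt (by norm_num : (0 : ℝ) < 1 / 2) (by norm_num)
      (by linarith : 1 < 3 * α)
    rw [Real.rpow_one] at this
    linarith
  have hbound (k : ℕ) : dist (dyadicSum T (roughGerm F X 𝕏) k) I ≤ C * r ^ k / (1 - r) :=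
    dist_le_of_le_geometric_of_tendsto r C hr1
      (dist_dyadicSum_le hT.le fun _ _ _ => norm_roughGerm_sub_add_le hK.le hα0.le hF2
        (hFb 2 (by norm_num)) hana₁ hana₂ halg) (hI.tendsto_dyadicSum hT) k
  have hboundn (n k : ℕ) :
      dist (dyadicSum T (roughGerm F (Xn n) (𝕏n n)) k) (In n) ≤ C * r ^ k / (1 - r) :=
    dist_le_of_le_geometric_of_tendsto r C hr1
      (dist_dyadicSum_le hT.le fun _ _ _ => norm_roughGerm_sub_add_le hK.le hα0.le hF2
        (hFb 2 (by norm_num)) (hana₁n n) (hana₂n n) (halgn n)) ((hIn n).tendsto_dyadicSum hT) k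
  have herr : Tendsto (fun k : ℕ => C * r ^ k / (1 - r)) atTop (𝓝 0) := by
    simpa using ((tendsto_pow_atTop_nhds_zero_of_lt_one hr0 hr1).const_mul C).div_const (1 - r)
  rw [Metric.tendsto_nhds]
  intro ε hε
  obtain ⟨k, hk⟩ := (herr.eventually (gt_mem_nhds (by positivity : 0 < ε / 3))).exists
  filter_upwards [Metric.tendsto_nhds.1 (hSlim k) (ε / 3) (by positivity)] with n hn
  have htri := dist_triangle4 (In n) (dyadicSum T (roughGerm F (Xn n) (𝕏n n)) k)
    (dyadicSum T (roughGerm F X 𝕏) k) I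
  rw [dist_comm (In n) (dyadicSum _ _ _)] at htri
  linarith [hbound k, hboundn n k]
end

section
/- Let α, β ∈ (0,1] with α + β > 1, let g : [0,T] → ℝ^d be β-Hölder continuous, and let f : [0,T] → L(ℝ^d, ℝ^m) be α-Hölder continuous. Then the left-point Riemann–Stieltjes sums converge: there exists I ∈ ℝ^m such that for every ε > 0 there is δ > 0 so that for every partition 0 = t₀ < t₁ < ⋯ < t_N = T with max_i (t_{i+1} − t_i) < δ one has ‖ Σ_i f(t_i)(g(t_{i+1}) − g(t_i)) − I ‖ < ε (the Young integral ∫₀^T f dg). -/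
open MeasureTheory

/-- If `A` is almost additive with a superlinear defect, the partial sums of `A` over consecutive
indices approximate `A` with an error that does not depend on the number of summands. -/
theorem norm_sum_Ico_sub_le_of_almost_additive {E : Type*} [NormedAddCommGroup E]
    {τ : ℕ → ℝ} (hτ : Monotone τ) {A : ℕ → ℕ → E} {K C θ : ℝ} (hK : 0 ≤ K) (hθ : 1 < θ)
    (hC : 2 * C * 2⁻¹ ^ θ + 2 * K ≤ C) (hC₀ : 0 ≤ C)
    (hA : ∀ i j k, i ≤ j → j ≤ k → ‖A i j + A j k - A i k‖ ≤ K * (τ k - τ i) ^ θ)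
    (a b : ℕ) (hab : a ≤ b) :
    ‖∑ i ∈ Finset.Ico a b, A i (i + 1) - A a b‖ ≤ C * (τ b - τ a) ^ θ := by
  have hθ₀ : 0 ≤ θ := by linarith
  induction h : b - a using Nat.strong_induction_on generalizing a b with
  | _ n ih =>
  rcases hab.eq_or_lt with rfl | hlt
  · have h0 := hA a a a le_rfl le_rfl
    simp only [sub_self, Real.zero_rpow (by linarith : θ ≠ 0), mul_zero, add_sub_cancel_left] at h0
    simpa [Real.zero_rpow (by linarith : θ ≠ 0)] using h0
  set L := τ b - τ a with hL
  have hL₀ : 0 ≤ L := sub_nonneg.2 (hτ hab)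
  obtain ⟨k, hak, hkb, hk₁, hk₂⟩ :
      ∃ k, a ≤ k ∧ k < b ∧ τ k - τ a ≤ L * 2⁻¹ ∧ τ b - τ (k + 1) ≤ L * 2⁻¹ := by
    classical
    have hex : ∃ j, a < j ∧ τ b - τ j ≤ L * 2⁻¹ := ⟨b, hlt, by simp; positivity⟩
    obtain ⟨hj₁, hj₂⟩ := Nat.find_spec hex
    have hjb : Nat.find hex ≤ b := Nat.find_min' hex ⟨hlt, by simp; positivity⟩
    have hmin := fun m => Nat.find_min (H := hex) (m := m)
    generalize Nat.find hex = j at *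
    obtain ⟨k, rfl⟩ : ∃ k, j = k + 1 := ⟨j - 1, by omega⟩
    refine ⟨k, by omega, by omega, ?_, hj₂⟩
    rcases (show a ≤ k by omega).eq_or_lt with rfl | hak
    · simp; positivity
    · have := hmin k (by omega)
      simp only [hak, true_and, not_le] at this
      linarith
  have h₁ := ih (k - a) (by omega) a k hak rfl
  have h₂ := ih (b - (k + 1)) (by omega) (k + 1) b hkb rfl
  have h₃ := hA a k b hak hkb.le
  have h₄ := hA k (k + 1) b (by omega) hkb
  have half {x : ℝ} (hx₀ : 0 ≤ x) (hx : x ≤ L * 2⁻¹) : C * x ^ θ ≤ C * (L ^ θ * 2⁻¹ ^ θ) := by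
    rw [← Real.mul_rpow hL₀ (by norm_num)]
    gcongr
  have h₁' := h₁.trans (half (sub_nonneg.2 (hτ hak)) hk₁)
  have h₂' := h₂.trans (half (sub_nonneg.2 (hτ hkb)) hk₂)
  have h₄' : ‖A k (k + 1) + A (k + 1) b - A k b‖ ≤ K * L ^ θ := by
    refine h₄.trans ?_
    have := hτ hkb.le
    have := hτ hak
    gcongr
    linarith
  have hsum : ∑ i ∈ Finset.Ico a b, A i (i + 1) - A a b =
      (∑ i ∈ Finset.Ico a k, A i (i + 1) - A a k) +
      (∑ i ∈ Finset.Ico (k + 1) b, A i (i + 1) - A (k + 1) b) +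
      (A a k + A k b - A a b) + (A k (k + 1) + A (k + 1) b - A k b) := by
    rw [← Finset.sum_Ico_consecutive _ hak hkb.le, Finset.sum_eq_sum_Ico_succ_bot hkb]
    abel
  rw [hsum]
  calc _ ≤ C * (L ^ θ * 2⁻¹ ^ θ) + C * (L ^ θ * 2⁻¹ ^ θ) + K * L ^ θ + K * L ^ θ :=
        norm_add₄_le.trans (by gcongr)
    _ = (2 * C * 2⁻¹ ^ θ + 2 * K) * L ^ θ := by ring
    _ ≤ C * L ^ θ := by gcongr

/-- **Sewing lemma on a finite set.** -/
theorem exists_norm_sub_sub_le_on_finset {X E : Type*} [LinearOrder X] [NormedAddCommGroup E]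
    {τ : X → ℝ} (hτ : Monotone τ) {A : X → X → E} {K C θ : ℝ} (hK : 0 ≤ K) (hθ : 1 < θ)
    (hC : 2 * C * 2⁻¹ ^ θ + 2 * K ≤ C) (hC₀ : 0 ≤ C)
    (hA : ∀ s u t, s ≤ u → u ≤ t → ‖A s u + A u t - A s t‖ ≤ K * (τ t - τ s) ^ θ)
    (P : Finset X) :
    ∃ h : X → E, ∀ s ∈ P, ∀ t ∈ P, s ≤ t → ‖h t - h s - A s t‖ ≤ C * (τ t - τ s) ^ θ := by
  rcases P.eq_empty_or_nonempty with rfl | hP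
  · exact ⟨fun _ => 0, by simp⟩
  have hcard := hP.card_pos
  let e := P.orderIsoOfFin rfl
  let x : ℕ → X := fun i => e ⟨min i (P.card - 1), by omega⟩
  have hx : Monotone x := fun i j hij =>
    e.monotone (Fin.mk_le_mk.2 (min_le_min_right _ hij))
  let idx : X → ℕ := fun s => if hs : s ∈ P then (e.symm ⟨s, hs⟩ : Fin P.card) else 0
  have hidx : ∀ s ∈ P, x (idx s) = s := by
    intro s hs
    have hlt := (e.symm ⟨s, hs⟩).isLt
    have : (⟨min (idx s) (P.card - 1), by omega⟩ : Fin P.card) = e.symm ⟨s, hs⟩ := by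
      ext
      simp only [idx, hs, dite_true]
      omega
    simp only [x, this, OrderIso.apply_symm_apply]
  refine ⟨fun s => ∑ i ∈ Finset.range (idx s), A (x i) (x (i + 1)), fun s hs t ht hst => ?_⟩
  have hle : idx s ≤ idx t := by
    simp only [idx, hs, ht, dite_true]
    exact e.symm.monotone hst
  have := norm_sum_Ico_sub_le_of_almost_additive (hτ.comp hx) (A := fun i j => A (x i) (x j))
    hK hθ hC hC₀ (fun i j k hij hjk => hA _ _ _ (hx hij) (hx hjk)) _ _ hle
  rwa [Finset.sum_Ico_eq_sub _ hle, Function.comp_apply, Function.comp_apply, hidx s hs,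
    hidx t ht] at this

/-- **Sewing lemma.** An almost additive two-parameter function with superlinear defect is close
to the increments of a one-parameter function. -/
theorem exists_norm_sub_sub_le_of_almost_additive {X E : Type*} [LinearOrder X]
    [NormedAddCommGroup E] [ProperSpace E]
    {τ : X → ℝ} (hτ : Monotone τ) {A : X → X → E} {K θ : ℝ} (hK : 0 ≤ K) (hθ : 1 < θ)
    (hA : ∀ s u t, s ≤ u → u ≤ t → ‖A s u + A u t - A s t‖ ≤ K * (τ t - τ s) ^ θ) :
    ∃ C : ℝ, 0 ≤ C ∧ ∃ h : X → E, ∀ s t, s ≤ t →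
      ‖h t - h s - A s t‖ ≤ C * (τ t - τ s) ^ θ := by
  have hq : (2⁻¹ : ℝ) ^ θ < 2⁻¹ := by
    simpa using Real.rpow_lt_rpow_of_exponent_gt (x := 2⁻¹) (by norm_num) (by norm_num) hθ
  have hq' : 0 < 1 - 2 * (2⁻¹ : ℝ) ^ θ := by linarith
  obtain ⟨C, hC₀, hC⟩ : ∃ C : ℝ, 0 ≤ C ∧ 2 * C * 2⁻¹ ^ θ + 2 * K ≤ C := by
    refine ⟨2 * K / (1 - 2 * 2⁻¹ ^ θ), by positivity, le_of_eq ?_⟩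
    generalize (2⁻¹ : ℝ) ^ θ = q at *
    field_simp
    ring
  refine ⟨C, hC₀, ?_⟩
  rcases isEmpty_or_nonempty X with _ | ⟨⟨x₀⟩⟩
  · exact ⟨fun _ => 0, fun s => isEmptyElim s⟩
  choose H hH using exists_norm_sub_sub_le_on_finset hτ hK hθ hC hC₀ hA
  let F : Ultrafilter (Finset X) := Ultrafilter.of Filter.atTop
  have hF (x : X) : ∀ᶠ P in (F : Filter (Finset X)), x ∈ P :=
    Ultrafilter.of_le _ <| (Filter.eventually_ge_atTop {x}).mono fun _ hP => by simpa using hP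
  have hlim (x : X) : ∃ y, Filter.Tendsto (fun P => H P x - H P x₀) F (nhds y) := by
    obtain ⟨R, hR⟩ : ∃ R, ∀ᶠ P in (F : Filter (Finset X)), ‖H P x - H P x₀‖ ≤ R := by
      rcases le_total x₀ x with hx | hx
      · refine ⟨C * (τ x - τ x₀) ^ θ + ‖A x₀ x‖, ?_⟩
        filter_upwards [hF x, hF x₀] with P hxP hx₀P
        have h₁ := hH P x₀ hx₀P x hxP hx
        have h₂ := norm_sub_norm_le (H P x - H P x₀) (A x₀ x)
        linarith
      · refine ⟨C * (τ x₀ - τ x) ^ θ + ‖A x x₀‖, ?_⟩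
        filter_upwards [hF x, hF x₀] with P hxP hx₀P
        have h₁ := hH P x hxP x₀ hx₀P hx
        have h₂ := norm_sub_norm_le (H P x₀ - H P x) (A x x₀)
        rw [norm_sub_rev]
        linarith
    obtain ⟨y, -, hy⟩ := (isCompact_closedBall (0 : E) R).ultrafilter_le_nhds
      (F.map fun P => H P x - H P x₀) (by
        rw [Filter.le_principal_iff]
        exact hR.mono fun P hP => by simpa using hP)
    exact ⟨y, hy⟩
  choose h hh using hlim
  refine ⟨h, fun s t hst => ?_⟩
  refine le_of_tendsto (((hh t).sub (hh s)).sub_const (A s t)).norm ?_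
  filter_upwards [hF s, hF t] with P hs ht
  simpa using hH P s hs t ht hst

theorem Fin.sum_succ_sub_castSucc {E : Type*} [AddCommGroup E] {N : ℕ} (h : Fin (N + 1) → E) :
    ∑ i : Fin N, (h i.succ - h i.castSucc) = h (Fin.last N) - h 0 := by
  induction N with
  | zero => simp
  | succ N ih =>
    rw [Fin.sum_univ_castSucc]
    have := ih fun i => h i.castSucc
    simp only [Fin.castSucc_zero] at this
    simp only [Fin.succ_castSucc, this, Fin.succ_last]
    abel

/-- **Young's theorem.** If `g : [0,T] → ℝ^d` is β-Hölder and
`f : [0,T] → L(ℝ^d, ℝ^m)` is α-Hölder with `α + β > 1` (`α, β ∈ (0,1]`), then the left-point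
Riemann–Stieltjes sums `Σᵢ f(tᵢ)(g(tᵢ₊₁) − g(tᵢ))` converge, as the mesh of the partition
of `[0,T]` tends to zero, to the Young integral `∫₀^T f dg`. -/
theorem young_integral_exists {d m : ℕ} (T α β Kf Kg : ℝ) (hT : 0 < T)
    (hα : 0 < α) (hα' : α ≤ 1) (hβ : 0 < β) (hβ' : β ≤ 1) (hαβ : 1 < α + β)
    (f : ℝ → EuclideanSpace ℝ (Fin d) →L[ℝ] EuclideanSpace ℝ (Fin m))
    (g : ℝ → EuclideanSpace ℝ (Fin d))
    (hf : ∀ s ∈ Set.Icc (0:ℝ) T, ∀ t ∈ Set.Icc (0:ℝ) T, ‖f t - f s‖ ≤ Kf * |t - s| ^ α)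
    (hg : ∀ s ∈ Set.Icc (0:ℝ) T, ∀ t ∈ Set.Icc (0:ℝ) T, ‖g t - g s‖ ≤ Kg * |t - s| ^ β) :
    ∃ I : EuclideanSpace ℝ (Fin m), ∀ ε > 0, ∃ δ > 0,
      ∀ (N : ℕ) (t : Fin (N + 1) → ℝ), StrictMono t → t 0 = 0 → t (Fin.last N) = T →
        (∀ i : Fin N, t i.succ - t i.castSucc < δ) →
        ‖(∑ i : Fin N, f (t i.castSucc) (g (t i.succ) - g (t i.castSucc))) - I‖ < ε := by
  have hKf : 0 ≤ Kf := by
    have h := (norm_nonneg _).trans (hf 0 ⟨le_rfl, hT.le⟩ T ⟨hT.le, le_rfl⟩)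
    rw [sub_zero, abs_of_pos hT] at h
    exact nonneg_of_mul_nonneg_left h (by positivity)
  have hKg : 0 ≤ Kg := by
    have h := (norm_nonneg _).trans (hg 0 ⟨le_rfl, hT.le⟩ T ⟨hT.le, le_rfl⟩)
    rw [sub_zero, abs_of_pos hT] at h
    exact nonneg_of_mul_nonneg_left h (by positivity)
  obtain ⟨C, hC, h, hh⟩ := exists_norm_sub_sub_le_of_almost_additive
    (X := Set.Icc (0 : ℝ) T) (τ := Subtype.val) (Subtype.mono_coe _)
    (A := fun s t => f s (g t - g s)) (K := Kf * Kg) (θ := α + β) (by positivity) hαβ (by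
      intro s u t hsu hut
      have hsu' : (s : ℝ) ≤ u := hsu
      have hut' : (u : ℝ) ≤ t := hut
      have heq : f s (g u - g s) + f u (g t - g u) - f s (g t - g s) =
          (f u - f s) (g t - g u) := by
        simp only [map_sub, sub_apply]
        abel
      have h₁ := hf s s.2 u u.2
      have h₂ := hg u u.2 t t.2
      rw [abs_of_nonneg (by linarith)] at h₁ h₂
      calc _ = ‖(f u - f s) (g t - g u)‖ := by rw [heq]
        _ ≤ ‖f u - f s‖ * ‖g t - g u‖ := ContinuousLinearMap.le_opNorm _ _
        _ ≤ (Kf * (u - s : ℝ) ^ α) * (Kg * (t - u : ℝ) ^ β) := by gcongr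
        _ ≤ (Kf * (t - s : ℝ) ^ α) * (Kg * (t - s : ℝ) ^ β) := by
          have hst : 0 ≤ (t - s : ℝ) ^ α := Real.rpow_nonneg (by linarith) α
          gcongr
        _ = Kf * Kg * (t - s : ℝ) ^ (α + β) := by
          rw [Real.rpow_add_of_nonneg (by linarith) hα.le hβ.le]
          ring)
  refine ⟨h ⟨T, hT.le, le_rfl⟩ - h ⟨0, le_rfl, hT.le⟩, fun ε hε => ?_⟩
  have hγ : 0 < α + β - 1 := by linarith
  refine ⟨(ε / (C * T + 1)) ^ (α + β - 1)⁻¹, by positivity, fun N t ht ht₀ htN hδ => ?_⟩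
  have hmem (i) : t i ∈ Set.Icc (0 : ℝ) T :=
    ⟨ht₀ ▸ ht.monotone (Fin.zero_le i), htN ▸ ht.monotone (Fin.le_last i)⟩
  have hI : h ⟨T, hT.le, le_rfl⟩ - h ⟨0, le_rfl, hT.le⟩ =
      ∑ i : Fin N, (h ⟨t i.succ, hmem _⟩ - h ⟨t i.castSucc, hmem _⟩) := by
    rw [Fin.sum_succ_sub_castSucc fun i => h ⟨t i, hmem i⟩]
    simp only [ht₀, htN]
  rw [hI, ← Finset.sum_sub_distrib]
  have hterm (i : Fin N) :
      ‖f (t i.castSucc) (g (t i.succ) - g (t i.castSucc)) -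
        (h ⟨t i.succ, hmem _⟩ - h ⟨t i.castSucc, hmem _⟩)‖ ≤
      C * (ε / (C * T + 1)) * (t i.succ - t i.castSucc) := by
    have hlt : 0 < t i.succ - t i.castSucc := sub_pos.2 (ht i.castSucc_lt_succ)
    have hpow : (t i.succ - t i.castSucc) ^ (α + β - 1) ≤ ε / (C * T + 1) := by
      have := Real.rpow_le_rpow hlt.le (hδ i).le hγ.le
      rwa [Real.rpow_inv_rpow (by positivity) hγ.ne'] at this
    rw [norm_sub_rev]
    refine (hh ⟨t i.castSucc, hmem _⟩ ⟨t i.succ, hmem _⟩ (sub_pos.1 hlt).le).trans ?_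
    calc C * (t i.succ - t i.castSucc) ^ (α + β)
        = C * (t i.succ - t i.castSucc) ^ (α + β - 1) * (t i.succ - t i.castSucc) := by
          rw [mul_assoc, ← Real.rpow_add_one hlt.ne', sub_add_cancel]
      _ ≤ _ := by gcongr
  calc _ ≤ ∑ i : Fin N, C * (ε / (C * T + 1)) * (t i.succ - t i.castSucc) :=
        norm_sum_le_of_le _ fun i _ => hterm i
    _ = C * (ε / (C * T + 1)) * T := by
        rw [← Finset.mul_sum, Fin.sum_succ_sub_castSucc, htN, ht₀, sub_zero]
    _ = ε * (C * T / (C * T + 1)) := by ring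
    _ < ε := mul_lt_of_lt_one_right hε ((div_lt_one (by positivity)).2 (by linarith))
end

section
/- There exists a constant C > 0 such that for all H, H′ ∈ [1/3, 1], ∫₀¹ ( r^{H − 1/2} − r^{H′ − 1/2} )² dr ≤ C (H − H′)². -/
open MeasureTheory

/-- On `(0, 1]`, the map `a ↦ r ^ a` is Lipschitz on `[c, ∞)` with constant `r ^ (c - t) / t`,
for every `t > 0`. -/
lemma abs_rpow_sub_rpow_le {r a b c t : ℝ} (hr : 0 < r) (hr1 : r ≤ 1) (ha : c ≤ a) (hb : c ≤ b)
    (ht : 0 < t) : |r ^ a - r ^ b| ≤ r ^ (c - t) / t * |a - b| := by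
  wlog hab : a ≤ b generalizing a b
  · rw [abs_sub_comm, abs_sub_comm a]
    exact this hb ha (le_of_not_ge hab)
  have hlog : -Real.log r ≤ r ^ (-t) / t := by
    have h := (abs_lt.1 (Real.abs_log_mul_self_rpow_lt r t hr hr1 ht)).1.le
    have hrt : 0 < r ^ t := Real.rpow_pos_of_pos hr t
    rw [Real.rpow_neg hr.le, ← one_div, div_div, mul_comm, ← div_div, le_div_iff₀ hrt]
    linarith
  have hexp : 1 - r ^ (b - a) ≤ (b - a) * -Real.log r := by
    have h := Real.add_one_le_exp (Real.log r * (b - a))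
    rw [← Real.rpow_def_of_pos hr] at h
    linarith
  have hmono : r ^ b ≤ r ^ a := Real.rpow_le_rpow_of_exponent_ge hr hr1 hab
  have hba : 0 ≤ b - a := sub_nonneg.2 hab
  rw [abs_of_nonneg (sub_nonneg.2 hmono), abs_sub_comm, abs_of_nonneg hba]
  calc r ^ a - r ^ b = r ^ a * (1 - r ^ (b - a)) := by
        rw [mul_sub, ← Real.rpow_add hr]; simp
    _ ≤ r ^ a * ((b - a) * (r ^ (-t) / t)) := by gcongr; exact hexp.trans (by gcongr)
    _ ≤ r ^ c * ((b - a) * (r ^ (-t) / t)) :=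
        mul_le_mul_of_nonneg_right (Real.rpow_le_rpow_of_exponent_ge hr hr1 ha) (by positivity)
    _ = r ^ (c - t) / t * (b - a) := by rw [sub_eq_add_neg c t, Real.rpow_add hr]; ring

/-- There is a constant `C > 0` such that for all Hurst parameters
`H, H′ ∈ [1/3, 1]`, `∫₀¹ (r^{H−1/2} − r^{H′−1/2})² dr ≤ C (H − H′)²`. This is the key
estimate for robustness of the drift estimator under misspecification of the Hurst
parameter of the driving (Volterra) fractional Brownian motion. -/
theorem volterra_kernel_L2_estimate :
    ∃ C : ℝ, 0 < C ∧ ∀ H ∈ Set.Icc (1/3 : ℝ) 1, ∀ H' ∈ Set.Icc (1/3 : ℝ) 1,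
      (∫ r in (0:ℝ)..1, (r ^ (H - 1/2) - r ^ (H' - 1/2)) ^ 2) ≤ C * (H - H') ^ 2 := by
  refine ⟨108, by norm_num, fun H hH H' hH' => ?_⟩
  have hint : IntervalIntegrable (fun r : ℝ => 36 * (H - H') ^ 2 * r ^ (-2/3 : ℝ)) volume 0 1 :=
    (intervalIntegral.intervalIntegrable_rpow' (by norm_num)).const_mul _
  have hval : ∫ r in (0:ℝ)..1, 36 * (H - H') ^ 2 * r ^ (-2/3 : ℝ) = 108 * (H - H') ^ 2 := by
    rw [intervalIntegral.integral_const_mul, integral_rpow (Or.inl (by norm_num))]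
    norm_num
    ring
  rw [← hval, intervalIntegral.integral_of_le zero_le_one,
    intervalIntegral.integral_of_le zero_le_one]
  refine integral_mono_of_nonneg (.of_forall fun r => sq_nonneg _) hint.1 ?_
  filter_upwards [ae_restrict_mem measurableSet_Ioc] with r hr
  have h := abs_rpow_sub_rpow_le (a := H - 1/2) (b := H' - 1/2) (c := -1/6) (t := 1/6) hr.1 hr.2
    (by linarith [hH.1]) (by linarith [hH'.1]) (by norm_num)
  have hsq : (r ^ (-1/6 - 1/6 : ℝ)) ^ 2 = r ^ (-2/3 : ℝ) := by
    rw [← Real.rpow_mul_natCast hr.1.le]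
    norm_num
  calc (r ^ (H - 1/2) - r ^ (H' - 1/2)) ^ 2 = |r ^ (H - 1/2) - r ^ (H' - 1/2)| ^ 2 :=
        (sq_abs _).symm
    _ ≤ (r ^ (-1/6 - 1/6 : ℝ) / (1/6) * |H - 1/2 - (H' - 1/2)|) ^ 2 := by gcongr
    _ = 36 * (H - H') ^ 2 * r ^ (-2/3 : ℝ) := by
        rw [mul_pow, sq_abs, div_pow, hsq]
        ring
end

section
/- There exist a continuous, piecewise continuously differentiable path x : [0,1] → ℝ² with span{ x(t) : t ∈ [0,1] } = ℝ² and 𝒜_{0,1/2}(x) = 0, and a sequence of continuous, piecewise continuously differentiable paths x⁽ⁿ⁾ : [0,1] → ℝ² such that sup_{t∈[0,1]} ‖x⁽ⁿ⁾(t) − x(t)‖ → 0 as n → ∞, while 𝒜_{0,1/2}(x⁽ⁿ⁾) ≥ 2^{n/2} for every n; in particular 𝒜_{0,1/2}(x⁽ⁿ⁾) → ∞, so the Lévy area functional is not continuous with respect to the supremum norm. -/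
open MeasureTheory Filter

/-- The Lévy area `𝒜_{s,t}(y) = ∫_s^t (y₁(r) − y₁(s)) y₂′(r) dr − ∫_s^t (y₂(r) − y₂(s)) y₁′(r) dr`
of a (piecewise C¹) planar path `y`. -/
noncomputable def levyArea (y : ℝ → ℝ × ℝ) (s t : ℝ) : ℝ :=
  ∫ r in s..t,
    (((y r).1 - (y s).1) * deriv (fun u => (y u).2) r -
      ((y r).2 - (y s).2) * deriv (fun u => (y u).1) r)

/-- `y` is piecewise continuously differentiable on `[a,b]`: there is a finite partition of
`[a,b]` such that `y` is C¹ on each closed subinterval. -/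
def PiecewiseC1On (y : ℝ → ℝ × ℝ) (a b : ℝ) : Prop :=
  ∃ (n : ℕ) (τ : Fin (n + 1) → ℝ), StrictMono τ ∧ τ 0 = a ∧ τ (Fin.last n) = b ∧
    ∀ i : Fin n, ContDiffOn ℝ 1 y (Set.Icc (τ i.castSucc) (τ i.succ))

/-- The vertical segment `t ↦ (1, t)` with a circular oscillation of radius `ε` and angular
frequency `ω` superimposed. -/
noncomputable def oscillatingSegment (ε ω t : ℝ) : ℝ × ℝ :=
  (1 + ε * Real.cos (ω * t), t + ε * Real.sin (ω * t))

lemma contDiff_oscillatingSegment (ε ω : ℝ) : ContDiff ℝ 1 (oscillatingSegment ε ω) := by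
  unfold oscillatingSegment
  fun_prop

lemma ContDiff.piecewiseC1On {y : ℝ → ℝ × ℝ} (hy : ContDiff ℝ 1 y) {a b : ℝ} (hab : a < b) :
    PiecewiseC1On y a b := by
  refine ⟨1, ![a, b], ?_, rfl, rfl, fun _ => hy.contDiffOn⟩
  intro i j hij
  fin_cases i <;> fin_cases j <;> simp_all

lemma norm_oscillatingSegment_sub_le {ε : ℝ} (hε : 0 ≤ ε) (ω t : ℝ) :
    ‖oscillatingSegment ε ω t - (1, t)‖ ≤ ε := by
  have hc := mul_le_of_le_one_right hε (Real.abs_cos_le_one (ω * t))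
  have hs := mul_le_of_le_one_right hε (Real.abs_sin_le_one (ω * t))
  simp [oscillatingSegment, Prod.norm_def, abs_of_nonneg hε, hc, hs]

lemma levyArea_oscillatingSegment (ε ω : ℝ) (hω : ω ≠ 0) (hcos : Real.cos (ω * (1 / 2)) = 1)
    (hsin : Real.sin (ω * (1 / 2)) = 0) :
    levyArea (oscillatingSegment ε ω) 0 (1 / 2) = ε ^ 2 * ω / 2 - ε := by
  have hl (r : ℝ) : HasDerivAt (fun u : ℝ => ω * u) ω r := by
    simpa using (hasDerivAt_id r).const_mul ω
  have h1 (r : ℝ) : deriv (fun u => (oscillatingSegment ε ω u).1) r =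
      ε * (-Real.sin (ω * r) * ω) :=
    (((hl r).cos.const_mul ε).const_add 1).deriv
  have h2 (r : ℝ) : deriv (fun u => (oscillatingSegment ε ω u).2) r =
      1 + ε * (Real.cos (ω * r) * ω) :=
    ((hasDerivAt_id r).add ((hl r).sin.const_mul ε)).deriv
  unfold levyArea
  simp only [h1, h2]
  rw [intervalIntegral.integral_eq_sub_of_hasDerivAt
    (f := fun t => (2 * ε / ω - ε ^ 2) * Real.sin (ω * t) + (ε ^ 2 * ω - ε) * t
      - ε * (t * Real.cos (ω * t)))]
  · simp only [hcos, hsin]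
    simp
    ring
  · intro r _
    have h := ((((hl r).sin.const_mul (2 * ε / ω - ε ^ 2)).add
      ((hasDerivAt_id r).const_mul (ε ^ 2 * ω - ε))).sub
      (((hasDerivAt_id r).mul (hl r).cos).const_mul ε))
    refine h.congr_deriv ?_
    simp only [oscillatingSegment, id, mul_zero, Real.cos_zero, Real.sin_zero]
    field_simp
    linear_combination (-ε ^ 2 * ω) * Real.sin_sq_add_cos_sq (ω * r)
  · apply Continuous.intervalIntegrable
    unfold oscillatingSegment
    fun_prop

/-- There are a continuous, piecewise C¹ path `x : [0,1] → ℝ²` with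
`span{x(t) : t ∈ [0,1]} = ℝ²` and `𝒜_{0,1/2}(x) = 0`, and continuous, piecewise C¹ paths
`x⁽ⁿ⁾` converging to `x` uniformly on `[0,1]`, such that `𝒜_{0,1/2}(x⁽ⁿ⁾) ≥ 2^{n/2}` for
every `n`; in particular the Lévy area functional is not continuous in supremum norm. -/
theorem levyArea_not_sup_norm_continuous :
    ∃ x : ℝ → ℝ × ℝ,
      ContinuousOn x (Set.Icc 0 1) ∧ PiecewiseC1On x 0 1 ∧
      Submodule.span ℝ (x '' Set.Icc 0 1) = ⊤ ∧
      levyArea x 0 (1/2) = 0 ∧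
      ∃ xs : ℕ → ℝ → ℝ × ℝ,
        (∀ n, ContinuousOn (xs n) (Set.Icc 0 1) ∧ PiecewiseC1On (xs n) 0 1) ∧
        Tendsto (fun n => ⨆ t : Set.Icc (0:ℝ) 1, ‖xs n t - x t‖) atTop (nhds 0) ∧
        ∀ n : ℕ, (2:ℝ) ^ ((n : ℝ) / 2) ≤ levyArea (xs n) 0 (1/2) := by
  have hx : ContDiff ℝ 1 (fun t : ℝ => ((1 : ℝ), t)) := by fun_prop
  refine ⟨fun t => (1, t), hx.continuous.continuousOn, hx.piecewiseC1On one_pos, ?_, ?_,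
    fun n => oscillatingSegment ((1 / 2) ^ n) (((8 ^ n : ℕ) : ℝ) * (2 * Real.pi) * 2),
    fun n => ⟨(contDiff_oscillatingSegment _ _).continuous.continuousOn,
      (contDiff_oscillatingSegment _ _).piecewiseC1On one_pos⟩, ?_, fun n => ?_⟩
  · rw [eq_top_iff]
    rintro ⟨a, b⟩ -
    have h0 : ((1 : ℝ), (0 : ℝ)) ∈ (fun t : ℝ => ((1 : ℝ), t)) '' Set.Icc 0 1 := ⟨0, by simp, rfl⟩
    have h1 : ((1 : ℝ), (1 : ℝ)) ∈ (fun t : ℝ => ((1 : ℝ), t)) '' Set.Icc 0 1 := ⟨1, by simp, rfl⟩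
    have h := Submodule.add_mem _
      (Submodule.smul_mem _ (a - b) (Submodule.subset_span (R := ℝ) h0))
      (Submodule.smul_mem _ b (Submodule.subset_span (R := ℝ) h1))
    simpa using h
  · simp [levyArea]
  · refine squeeze_zero (fun n => Real.iSup_nonneg fun _ => norm_nonneg _)
      (fun n => ciSup_le fun t => norm_oscillatingSegment_sub_le (by positivity) _ _)
      (tendsto_pow_atTop_nhds_zero_of_lt_one (by norm_num) (by norm_num : (1 / 2 : ℝ) < 1))
  · have hω : ((8 ^ n : ℕ) : ℝ) * (2 * Real.pi) * 2 * (1 / 2) =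
        ((8 ^ n : ℕ) : ℝ) * (2 * Real.pi) := by
      ring
    rw [levyArea_oscillatingSegment _ _ (by positivity)
      (by rw [hω]; exact Real.cos_nat_mul_two_pi _)
      (by rw [hω, ← zero_add (_ * _), Real.sin_add_nat_mul_two_pi, Real.sin_zero])]
    have h8 : ((1 / 2 : ℝ) ^ n) ^ 2 * 8 ^ n = 2 ^ n := by
      rw [← pow_mul, mul_comm n 2, pow_mul, ← mul_pow]
      norm_num
    have hε : (1 / 2 : ℝ) ^ n ≤ 1 := pow_le_one₀ (by norm_num) (by norm_num)
    have h2 : (1 : ℝ) ≤ 2 ^ n := one_le_pow₀ (by norm_num)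
    have hpow : (2 : ℝ) ^ ((n : ℝ) / 2) ≤ 2 ^ n := by
      rw [← Real.rpow_natCast]
      exact Real.rpow_le_rpow_of_exponent_le (by norm_num) (half_le_self n.cast_nonneg)
    have harea : ((1 / 2 : ℝ) ^ n) ^ 2 * (((8 ^ n : ℕ) : ℝ) * (2 * Real.pi) * 2) / 2
        = 2 ^ n * (2 * Real.pi) := by
      rw [← h8]
      push_cast
      ring
    rw [harea]
    nlinarith [Real.pi_gt_three]
end

section
/- Let T > 0, let h : ℝ^d → ℝ^d be continuous, and let C : ℝ^d → Sym_d(ℝ) be continuous with C(x) positive definite for every x. Let X ∈ C([0,T], ℝ^d) satisfy span{ h(X_t) : t ∈ [0,T] } = ℝ^d, and let Xₙ → X uniformly on [0,T]. Then for all sufficiently large n the bilinear form B_{Xₙ} on d×d matrices is positive definite, and the inverses of the associated positive symmetric linear operators Q(Xₙ) (defined by ⟨⟨M, Q(Xₙ) N⟩⟩ = B_{Xₙ}(M, N), with ⟨⟨·,·⟩⟩ the Frobenius inner product on matrices) converge in operator norm to Q(X)^{-1}. -/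
open MeasureTheory Matrix
open scoped RealInnerProductSpace

/-- A `d×d` matrix `M`, represented as an element of `ℝ^{d×d}` with the Frobenius (Euclidean)
inner product, acting on a vector `v ∈ ℝ^d`. -/
def matVec {d : ℕ} (M : EuclideanSpace ℝ (Fin d × Fin d)) (v : Fin d → ℝ) : Fin d → ℝ :=
  fun i => ∑ j, M (i, j) * v j

/-- The observed Fisher information bilinear form
`B_X(M,N) = ∫₀^T ⟨M h(X_s), C(X_s)⁻¹ N h(X_s)⟩ ds` on `d×d` matrices. -/
noncomputable def fisherForm {d : ℕ} (T : ℝ) (h : (Fin d → ℝ) → Fin d → ℝ)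
    (C : (Fin d → ℝ) → Matrix (Fin d) (Fin d) ℝ) (X : ℝ → Fin d → ℝ)
    (M N : EuclideanSpace ℝ (Fin d × Fin d)) : ℝ :=
  ∫ s in (0:ℝ)..T, (matVec M (h (X s))) ⬝ᵥ ((C (X s))⁻¹.mulVec (matVec N (h (X s))))

open Filter Topology

theorem ContinuousLinearMap.tendsto_of_forall_apply {ι E F : Type*} [NormedAddCommGroup E]
    [NormedSpace ℝ E] [FiniteDimensional ℝ E] [NormedAddCommGroup F] [NormedSpace ℝ F]
    {l : Filter ι} {f : ι → E →L[ℝ] F} {g : E →L[ℝ] F}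
    (hfg : ∀ y, Tendsto (fun i => f i y) l (𝓝 (g y))) : Tendsto f l (𝓝 g) := by
  let e : (E →L[ℝ] F) ≃L[ℝ] Fin (Module.finrank ℝ E) → F :=
    ((ContinuousLinearEquiv.ofFinrankEq (Module.finrank_fin_fun ℝ).symm).arrowCongr
      (1 : F ≃L[ℝ] F)).trans (ContinuousLinearEquiv.piRing _)
  rw [e.toHomeomorph.isInducing.tendsto_nhds_iff]
  exact tendsto_pi_nhds.mpr fun i => hfg _

theorem EuclideanSpace.tendsto_of_forall_inner {ι κ : Type*} [Fintype κ]
    {l : Filter ι} {f : ι → EuclideanSpace ℝ κ} {g : EuclideanSpace ℝ κ}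
    (hfg : ∀ y : EuclideanSpace ℝ κ, Tendsto (fun i => ⟪y, f i⟫) l (𝓝 ⟪y, g⟫)) :
    Tendsto f l (𝓝 g) := by
  classical
  rw [(EuclideanSpace.equiv κ ℝ).toHomeomorph.isInducing.tendsto_nhds_iff, tendsto_pi_nhds]
  intro i
  simpa [EuclideanSpace.inner_single_left] using hfg (EuclideanSpace.single i 1)

/-- Along a sequence of paths converging uniformly on `[a, b]`, integrals of a continuous function
of the path converge. -/
theorem TendstoUniformlyOn.tendsto_intervalIntegral_comp {E : Type*} [PseudoMetricSpace E]
    [ProperSpace E] {a b : ℝ} (hab : a ≤ b) {X : ℝ → E} {Y : ℕ → ℝ → E} {g : E → ℝ}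
    (hg : Continuous g) (hX : ContinuousOn X (Set.Icc a b))
    (hY : ∀ n, ContinuousOn (Y n) (Set.Icc a b))
    (hYX : TendstoUniformlyOn Y X atTop (Set.Icc a b)) :
    Tendsto (fun n => ∫ s in a..b, g (Y n s)) atTop (𝓝 (∫ s in a..b, g (X s))) := by
  have hK : IsCompact (Metric.cthickening 1 (X '' Set.Icc a b)) :=
    (isCompact_Icc.image_of_continuousOn hX).cthickening
  obtain ⟨B, hB⟩ := hK.exists_bound_of_continuousOn hg.continuousOn
  have hsub : Set.uIoc a b ⊆ Set.Icc a b := by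
    rw [Set.uIoc_of_le hab]; exact Set.Ioc_subset_Icc_self
  refine intervalIntegral.tendsto_integral_filter_of_dominated_convergence (fun _ => B)
    (.of_forall fun n => ?_) ?_ intervalIntegrable_const (.of_forall fun s hs => ?_)
  · exact ((hg.comp_continuousOn (hY n)).mono hsub).aestronglyMeasurable measurableSet_uIoc
  · filter_upwards [Metric.tendstoUniformlyOn_iff.mp hYX 1 one_pos] with n hn
    refine .of_forall fun s hs => hB _ ?_
    refine Metric.mem_cthickening_of_dist_le _ _ _ _ (Set.mem_image_of_mem X (hsub hs)) ?_
    rw [dist_comm]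
    exact (hn s (hsub hs)).le
  · exact (hg.tendsto _).comp (hYX.tendsto_at (hsub hs))

theorem continuous_matVec {d : ℕ} (M : EuclideanSpace ℝ (Fin d × Fin d)) :
    Continuous (matVec M) := by
  unfold matVec
  fun_prop

theorem eq_zero_of_matVec_eq_zero_of_span_eq_top {d : ℕ}
    {M : EuclideanSpace ℝ (Fin d × Fin d)} {s : Set (Fin d → ℝ)}
    (hs : Submodule.span ℝ s = ⊤) (hM : ∀ v ∈ s, matVec M v = 0) : M = 0 := by
  have hzero : (Matrix.of fun i j => M (i, j)).mulVecLin = 0 := LinearMap.ext_on hs hM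
  have hmat : (Matrix.of fun i j => M (i, j)) = 0 :=
    Matrix.mulVec_injective (congrArg DFunLike.coe (hzero.trans Matrix.mulVecLin_zero.symm))
  ext ⟨i, j⟩
  exact congrFun (congrFun hmat i) j

theorem continuous_fisher_integrand {d : ℕ} {h : (Fin d → ℝ) → Fin d → ℝ} (hh : Continuous h)
    {C : (Fin d → ℝ) → Matrix (Fin d) (Fin d) ℝ} (hC : Continuous C)
    (hCpd : ∀ x, (C x).PosDef) (M N : EuclideanSpace ℝ (Fin d × Fin d)) :
    Continuous fun x => matVec M (h x) ⬝ᵥ ((C x)⁻¹.mulVec (matVec N (h x))) := by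
  have hCinv : Continuous fun x => (C x)⁻¹ := by
    refine continuous_iff_continuousAt.mpr fun x => ContinuousAt.comp ?_ hC.continuousAt
    refine continuousAt_matrix_inv _ ?_
    rw [Ring.inverse_eq_inv']
    exact continuousAt_inv₀ (hCpd x).det_pos.ne'
  exact ((continuous_matVec M).comp hh).dotProduct
    (hCinv.matrix_mulVec ((continuous_matVec N).comp hh))

theorem fisherForm_self_pos_of_exists_ne_zero {d : ℕ} {T : ℝ} (hT : 0 < T)
    {h : (Fin d → ℝ) → Fin d → ℝ} (hh : Continuous h)
    {C : (Fin d → ℝ) → Matrix (Fin d) (Fin d) ℝ} (hC : Continuous C)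
    (hCpd : ∀ x, (C x).PosDef) {X : ℝ → Fin d → ℝ} (hX : ContinuousOn X (Set.Icc 0 T))
    {M : EuclideanSpace ℝ (Fin d × Fin d)}
    (hM : ∃ t ∈ Set.Icc 0 T, matVec M (h (X t)) ≠ 0) : 0 < fisherForm T h C X M M := by
  refine intervalIntegral.integral_pos hT
    ((continuous_fisher_integrand hh hC hCpd M M).comp_continuousOn hX) (fun t _ => ?_) ?_
  · simpa using (hCpd (X t)).inv.posSemidef.dotProduct_mulVec_nonneg (matVec M (h (X t)))
  · obtain ⟨t, ht, hne⟩ := hM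
    exact ⟨t, ht, by simpa using (hCpd (X t)).inv.dotProduct_mulVec_pos hne⟩

theorem fisherForm_eq_zero_of_matVec_eq_zero {d : ℕ} {T : ℝ} (hT : 0 ≤ T)
    {h : (Fin d → ℝ) → Fin d → ℝ} {C : (Fin d → ℝ) → Matrix (Fin d) (Fin d) ℝ}
    {X : ℝ → Fin d → ℝ} {N : EuclideanSpace ℝ (Fin d × Fin d)}
    (hN : ∀ t ∈ Set.Icc 0 T, matVec N (h (X t)) = 0) (M : EuclideanSpace ℝ (Fin d × Fin d)) :
    fisherForm T h C X M N = 0 := by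
  refine intervalIntegral.integral_zero_ae (.of_forall fun t ht => ?_)
  rw [Set.uIoc_of_le hT] at ht
  simp [hN t (Set.Ioc_subset_Icc_self ht)]

theorem fisherForm_self_pos_of_injective {d : ℕ} {T : ℝ} (hT : 0 < T)
    {h : (Fin d → ℝ) → Fin d → ℝ} (hh : Continuous h)
    {C : (Fin d → ℝ) → Matrix (Fin d) (Fin d) ℝ} (hC : Continuous C)
    (hCpd : ∀ x, (C x).PosDef) {X : ℝ → Fin d → ℝ} (hX : ContinuousOn X (Set.Icc 0 T))
    {Q : EuclideanSpace ℝ (Fin d × Fin d) →L[ℝ] EuclideanSpace ℝ (Fin d × Fin d)}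
    (hQ : ∀ M N : EuclideanSpace ℝ (Fin d × Fin d), ⟪M, Q N⟫ = fisherForm T h C X M N)
    (hinj : Function.Injective Q) {M : EuclideanSpace ℝ (Fin d × Fin d)} (hM : M ≠ 0) :
    0 < fisherForm T h C X M M := by
  refine fisherForm_self_pos_of_exists_ne_zero hT hh hC hCpd hX ?_
  by_contra! hzero
  refine hM (hinj ?_)
  rw [map_zero, ← inner_self_eq_zero (𝕜 := ℝ), hQ]
  exact fisherForm_eq_zero_of_matVec_eq_zero hT.le hzero _

/-- Suppose `span{h(X_t) : t ∈ [0,T]} = ℝ^d` and `Xₙ → X` uniformly on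
`[0,T]`. Let `Q` and `Qₙ` be the symmetric linear operators representing the Fisher forms
`B_X` and `B_{Xₙ}` via the Frobenius inner product, `⟪M, Q N⟫ = B_X(M,N)`. Then for all
sufficiently large `n` the form `B_{Xₙ}` is positive definite, and the inverses `Qₙ⁻¹`
converge in operator norm to `Q⁻¹`. -/
theorem fisher_inverse_continuous {d : ℕ} (T : ℝ) (hT : 0 < T)
    (h : (Fin d → ℝ) → Fin d → ℝ) (hh : Continuous h)
    (C : (Fin d → ℝ) → Matrix (Fin d) (Fin d) ℝ) (hC : Continuous C)
    (hCpd : ∀ x, (C x).PosDef)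
    (X : ℝ → Fin d → ℝ) (hX : ContinuousOn X (Set.Icc 0 T))
    (hspan : Submodule.span ℝ ((fun t => h (X t)) '' Set.Icc 0 T) = ⊤)
    (Xn : ℕ → ℝ → Fin d → ℝ) (hXn : ∀ n, ContinuousOn (Xn n) (Set.Icc 0 T))
    (hconv : TendstoUniformlyOn Xn X Filter.atTop (Set.Icc 0 T))
    (Q : EuclideanSpace ℝ (Fin d × Fin d) →L[ℝ] EuclideanSpace ℝ (Fin d × Fin d))
    (Qn : ℕ → EuclideanSpace ℝ (Fin d × Fin d) →L[ℝ] EuclideanSpace ℝ (Fin d × Fin d))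
    (hQ : ∀ M N : EuclideanSpace ℝ (Fin d × Fin d), ⟪M, Q N⟫ = fisherForm T h C X M N)
    (hQn : ∀ n, ∀ M N : EuclideanSpace ℝ (Fin d × Fin d),
      ⟪M, Qn n N⟫ = fisherForm T h C (Xn n) M N) :
    (∃ N₀ : ℕ, ∀ n ≥ N₀, ∀ M : EuclideanSpace ℝ (Fin d × Fin d), M ≠ 0 →
        0 < fisherForm T h C (Xn n) M M) ∧
      Filter.Tendsto (fun n => (Qn n).inverse) Filter.atTop (nhds Q.inverse) := by
  have hlim : Tendsto Qn atTop (𝓝 Q) := by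
    refine ContinuousLinearMap.tendsto_of_forall_apply fun N =>
      EuclideanSpace.tendsto_of_forall_inner fun M => ?_
    simp_rw [hQ, hQn]
    exact TendstoUniformlyOn.tendsto_intervalIntegral_comp
      (g := fun x => matVec M (h x) ⬝ᵥ ((C x)⁻¹.mulVec (matVec N (h x)))) hT.le
      (continuous_fisher_integrand hh hC hCpd M N) hX hXn hconv
  have hinj : Function.Injective Q := by
    refine (injective_iff_map_eq_zero Q).mpr fun M hM => ?_
    by_contra hne
    have hpos : 0 < fisherForm T h C X M M := by
      refine fisherForm_self_pos_of_exists_ne_zero hT hh hC hCpd hX ?_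
      by_contra! hzero
      exact hne (eq_zero_of_matVec_eq_zero_of_span_eq_top hspan
        (Set.forall_mem_image.mpr hzero))
    rw [← hQ, hM, inner_zero_right] at hpos
    exact hpos.false
  have hunit : IsUnit Q := ContinuousLinearMap.isUnit_iff_bijective.mpr
    ⟨hinj, (LinearMap.injective_iff_surjective (f := Q.toLinearMap)).mp hinj⟩
  constructor
  · obtain ⟨N₀, hN₀⟩ := eventually_atTop.mp (hlim.eventually (Units.isOpen.mem_nhds hunit))
    exact ⟨N₀, fun n hn M hM => fisherForm_self_pos_of_injective hT hh hC hCpd (hXn n) (hQn n)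
      (ContinuousLinearMap.isUnit_iff_bijective.mp (hN₀ n hn)).injective hM⟩
  · obtain ⟨u, rfl⟩ := hunit
    simpa only [ContinuousLinearMap.ringInverse_eq_inverse, Function.comp_def] using
      (NormedRing.inverse_continuousAt u).tendsto.comp hlim
end
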